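/- arXiv:2011.14056 — 4 statements merged into one kernel-verified Lean document; each statement's English description precedes it below -/
import Mathlib

section
/- Let C be a category with a terminal object ⊤. Then C is thin (every hom-type of C is a subsingleton) if and only if for every object X of C the unique morphism X ⟶ ⊤ is a monomorphism. -/
open CategoryTheory CategoryTheory.Limits

/-- A category `C` with a terminal object is thin (every hom-type is a subsingleton)
iff for every object `X` the unique morphism `X ⟶ ⊤` is a monomorphism. -/
theorem thin_iff_mono_terminalFrom {C : Type*} [Category C] [HasTerminal C] :
    Quiver.IsThin C ↔ ∀ X : C, Mono (terminal.from X) := by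
  constructor
  · intro h X
    exact ⟨fun f g _ => (h _ _).elim f g⟩
  · intro h X Y
    refine ⟨fun f g => ?_⟩
    have := h Y
    exact (cancel_mono (terminal.from Y)).1 (Subsingleton.elim _ _)
end

section
/- Let C be a thin category with a terminal object ⊤. Then C is equivalent, as a category, to Subobject ⊤, the poset of subobjects of the terminal object regarded as a category. -/
open CategoryTheory CategoryTheory.Limits

/-- A thin category with a terminal object is equivalent to the poset of subobjects
of the terminal object, regarded as a category. -/
theorem thin_equivalence_subobject_terminal {C : Type*} [Category C] [HasTerminal C]
    (h : Quiver.IsThin C) : Nonempty (C ≌ Subobject (⊤_ C)) := by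
  have hm : ∀ {X Y : C} (f : X ⟶ Y), Mono f := fun f => ⟨fun _ _ _ => (h _ _).elim _ _⟩
  let F : Subobject (⊤_ C) ⥤ C := Subobject.underlying
  have h1 : F.Faithful := ⟨fun _ => Subsingleton.elim _ _⟩
  have h2 : F.Full := ⟨fun {X Y} f =>
    ⟨homOfLE (Subobject.le_of_comm f ((h _ _).elim _ _)), (h _ _).elim _ _⟩⟩
  have h3 : F.EssSurj := ⟨fun X => by
    haveI := hm (terminal.from X)
    exact ⟨Subobject.mk (terminal.from X), ⟨Subobject.underlyingIso _⟩⟩⟩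
  have h4 : F.IsEquivalence := { }
  exact ⟨F.asEquivalence.symm⟩
end

section
/- Let C be a category with a terminal object ⊤. The underlying functor Subobject ⊤ ⥤ C, sending a subobject of ⊤ to its underlying object, is an equivalence of categories if and only if for every object X of C the unique morphism X ⟶ ⊤ is a monomorphism. -/
open CategoryTheory CategoryTheory.Limits

/-- The underlying functor `Subobject ⊤ ⥤ C` is an equivalence of categories iff
every object's unique morphism to the terminal object is a monomorphism. -/
theorem subobjectTerminal_underlying_isEquivalence_iff {C : Type*} [Category C]
    [HasTerminal C] :
    (Subobject.underlying (X := (⊤_ C))).IsEquivalence ↔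
      ∀ X : C, Mono (terminal.from X) := by
  constructor
  · intro h X
    let e := (Subobject.underlying (X := (⊤_ C))).objObjPreimageIso X
    have : terminal.from X = e.inv ≫ Subobject.arrow _ := Subsingleton.elim _ _
    rw [this]
    exact mono_comp _ _
  · intro h
    exact
      { faithful := ⟨fun _ => Subsingleton.elim _ _⟩
        full := ⟨fun {A B} f =>
          ⟨(Subobject.le_of_comm f (Subsingleton.elim _ _)).hom, by
            rw [← cancel_mono B.arrow]; exact Subsingleton.elim _ _⟩⟩
        essSurj := ⟨fun X =>
          ⟨Subobject.mk (terminal.from X), ⟨Subobject.underlyingIso (terminal.from X)⟩⟩⟩ }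
end

section
/- Let L be a first-order language and T an L-theory. The following are equivalent: (a) in every model M of T, any two elements are equal (T ⊨ ∀x∀y, x = y); (b) for every n and every L-formula φ with free variables indexed by Fin n, there exists an L-sentence σ such that for every model M of T and every valuation v : Fin n → M, φ is realized at v in M if and only if σ holds in M. -/
open FirstOrder

/-- For a first-order theory `T`: every model of `T` has at most one element iff
every formula is, over models of `T`, equivalent to a sentence. -/
theorem models_subsingleton_iff_every_formula_equiv_sentence
    {L : FirstOrder.Language} (T : L.Theory) :
    (∀ (M : Type w) [L.Structure M] [Nonempty M], M ⊨ T → ∀ x y : M, x = y) ↔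
      (∀ (n : ℕ) (φ : L.Formula (Fin n)), ∃ σ : L.Sentence,
        ∀ (M : Type w) [L.Structure M] [Nonempty M], M ⊨ T →
          ∀ v : Fin n → M, (φ.Realize v ↔ M ⊨ σ)) := by
  constructor
  · intro h n φ
    refine ⟨Language.Formula.iAlls (α := Empty) (Fin n) (φ.relabel Sum.inr), ?_⟩
    intro M _ _ hM v
    have hs : Subsingleton (Fin n → M) :=
      ⟨fun a b => funext fun i => h M hM (a i) (b i)⟩
    rw [Language.Sentence.Realize, Language.Formula.realize_iAlls]
    simp only [Language.Formula.realize_relabel]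
    constructor
    · intro hv i
      have e : (Sum.elim (default : Empty → M) i) ∘ Sum.inr = v := Subsingleton.elim _ _
      rw [e]
      exact hv
    · intro hv
      exact hv v
  · intro h M _ _ hM x y
    obtain ⟨σ, hσ⟩ := h 2 (Language.Term.equal (Language.var 0) (Language.var 1))
    have h1 := hσ M hM ![x, x]
    have h2 := hσ M hM ![x, y]
    simp only [Language.Formula.realize_equal, Language.Term.realize_var] at h1 h2
    exact h2.2 (h1.1 rfl)
end
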